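/- Let ε > 0 with 6ε ≤ 1, and let (G, w) be an ε-coherent weighted graph, where G is hole-with-hat-free. Let 𝒜 be the union of all the sets A over all fractures (A, C, D, B) of G. Then w(𝒜) < 3ε. -/

import Mathlib

open Finset

namespace EHhat

variable {V : Type*}

/-- `c : ZMod n → V` describes a hole (induced cycle of length `n ≥ 4`) in `G`. -/
def IsHole (G : SimpleGraph V) (n : ℕ) (c : ZMod n → V) : Prop :=
  4 ≤ n ∧ Function.Injective c ∧
    ∀ i j : ZMod n, G.Adj (c i) (c j) ↔ (i - j = 1 ∨ j - i = 1)

/-- `G` contains a hole together with a hat: a vertex outside the hole with exactly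
two neighbours on the hole, and these two neighbours are adjacent (consecutive). -/
def HasHoleWithHat (G : SimpleGraph V) : Prop :=
  ∃ (n : ℕ) (c : ZMod n → V) (v : V) (i : ZMod n),
    IsHole G n c ∧ (∀ j, v ≠ c j) ∧ (∀ j, G.Adj v (c j) ↔ (j = i ∨ j = i + 1))

def HoleWithHatFree (G : SimpleGraph V) : Prop := ¬ HasHoleWithHat G

/-- A graph is perfect if chromatic number equals clique number for
every induced subgraph. -/
def IsPerfect [Fintype V] (G : SimpleGraph V) : Prop :=
  ∀ S : Finset V,
    (G.induce (S : Set V)).chromaticNumber = ((G.induce (S : Set V)).cliqueNum : ℕ∞)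

/-- `f` is a good function on `G`: it is nonnegative and sums to at most 1 on
every perfect induced subgraph of `G`. -/
def GoodOn [Fintype V] (G : SimpleGraph V) (f : V → ℝ) : Prop :=
  (∀ v, 0 ≤ f v) ∧
  ∀ S : Finset V, IsPerfect (G.induce (S : Set V)) → ∑ v ∈ S, f v ≤ 1

/-- `G` is `α`-narrow if `∑ v, f v ^ α ≤ 1` for every good function `f` on `G`. -/
def Narrow [Fintype V] (G : SimpleGraph V) (α : ℝ) : Prop :=
  ∀ f : V → ℝ, GoodOn G f → ∑ v, f v ^ α ≤ 1

/-- `(G, f)` is an `α`-critical pair. -/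
def Critical [Fintype V] (G : SimpleGraph V) (f : V → ℝ) (α : ℝ) : Prop :=
  GoodOn G f ∧
  (∀ S : Finset V, S ≠ Finset.univ → Narrow (G.induce (S : Set V)) α) ∧
  1 < ∑ v, f v ^ α

/-- `A` is complete to `B`. -/
def CompleteTo (G : SimpleGraph V) (A B : Set V) : Prop :=
  ∀ a ∈ A, ∀ b ∈ B, G.Adj a b

/-- `A` is anticomplete to `B`. -/
def AnticompleteTo (G : SimpleGraph V) (A B : Set V) : Prop :=
  ∀ a ∈ A, ∀ b ∈ B, ¬ G.Adj a b

/-- The vertex `v` is complete to the set `C`. -/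
def VertCompleteTo (G : SimpleGraph V) (v : V) (C : Set V) : Prop :=
  ∀ c ∈ C, G.Adj v c

/-- The vertex `v` is mixed on `C`: it has both a neighbour and a non-neighbour in `C`. -/
def MixedOn (G : SimpleGraph V) (v : V) (C : Set V) : Prop :=
  (∃ c ∈ C, G.Adj v c) ∧ (∃ c ∈ C, ¬ G.Adj v c)

/-- `X ⊆ V(G)` is connected: `G[X]` is a connected graph. -/
def ConnSet (G : SimpleGraph V) (X : Set V) : Prop :=
  (G.induce X).Connected

/-- `X ⊆ V(G)` is anticonnected: the complement of `G[X]` is a connected graph. -/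
def AnticonnSet (G : SimpleGraph V) (X : Set V) : Prop :=
  ((G.induce X)ᶜ).Connected

/-- The sum of `f` over a set `X` of vertices. -/
noncomputable def setSum [Fintype V] (f : V → ℝ) (X : Set V) : ℝ :=
  ∑ v, X.indicator f v

/-- `w` is a weight function making `(G, w)` a weighted graph. -/
def IsWeight [Fintype V] (w : V → ℝ) : Prop :=
  (∀ v, 0 ≤ w v) ∧ ∑ v, w v = 1

/-- The weighted graph `(G, w)` is `ε`-coherent. -/
def Coherent [Fintype V] (G : SimpleGraph V) (w : V → ℝ) (ε : ℝ) : Prop :=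
  (∀ v, w v < ε) ∧
  (∀ v, setSum w (G.neighborSet v) < ε) ∧
  ∀ A B : Set V, Disjoint A B → AnticompleteTo G A B →
    min (setSum w A) (setSum w B) < ε

/-- `Y` is (the vertex set of) a component of `G[X]`: a maximal connected subset of `X`. -/
def IsCompOf (G : SimpleGraph V) (X Y : Set V) : Prop :=
  Y ⊆ X ∧ ConnSet G Y ∧
  ∀ Z : Set V, Y ⊆ Z → Z ⊆ X → ConnSet G Z → Z = Y

/-- `Y` is the big component of `G[X]` (with respect to the weight `w` and `ε`). -/
def IsBigComp [Fintype V] (G : SimpleGraph V) (w : V → ℝ) (ε : ℝ) (X Y : Set V) : Prop :=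
  IsCompOf G X Y ∧ setSum w X - ε < setSum w Y

/-- `v` is an attachment of `A`: a vertex outside `A` with a neighbour in `A`. -/
def IsAttachment (G : SimpleGraph V) (A : Set V) (v : V) : Prop :=
  v ∉ A ∧ ∃ a ∈ A, G.Adj v a

/-- `(C, D)` is a split of the weighted graph `(G, w)`. -/
def IsSplit [Fintype V] (G : SimpleGraph V) (w : V → ℝ) (ε : ℝ) (C D : Set V) : Prop :=
  Disjoint C D ∧ 2 ≤ C.ncard ∧ ConnSet G C ∧ AnticonnSet G C ∧
  D.Nonempty ∧ D = {v | v ∉ C ∧ ∀ c ∈ C, G.Adj v c} ∧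
  ∀ Y : Set V, IsBigComp G w ε ((C ∪ D)ᶜ) Y → ∀ c ∈ C, ¬ IsAttachment G Y c

/-- A split is optimal if its first part is maximal among splits. -/
def IsOptimalSplit [Fintype V] (G : SimpleGraph V) (w : V → ℝ) (ε : ℝ) (C D : Set V) : Prop :=
  IsSplit G w ε C D ∧ ∀ C' D' : Set V, IsSplit G w ε C' D' → C ⊆ C' → C' = C

/-- `(A, C, D, B)` is a fracture of `(G, w)`: `(C, D)` is an optimal split, `A` is the union
of the components of `G \ (C ∪ D)` with an attachment in `C`, and `B` is the rest. -/
def IsFracture [Fintype V] (G : SimpleGraph V) (w : V → ℝ) (ε : ℝ)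
    (A C D B : Set V) : Prop :=
  IsOptimalSplit G w ε C D ∧
  A = {v | ∃ Y : Set V, IsCompOf G ((C ∪ D)ᶜ) Y ∧ v ∈ Y ∧ ∃ c ∈ C, IsAttachment G Y c} ∧
  B = ((C ∪ D)ᶜ : Set V) \ A

/-- The generating relation for the forcer graph: vertices `0,1,2,3` and `4,5,6,7`
each induce a path, and the two quadruples are complete to each other. -/
def forcerRel (i j : Fin 8) : Prop :=
  (i.val < 4 ∧ 4 ≤ j.val) ∨ j.val = i.val + 1

/-- The forcer graph. -/
def forcer : SimpleGraph (Fin 8) := SimpleGraph.fromRel forcerRel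

def ForcerFree (G : SimpleGraph V) : Prop := IsEmpty (forcer ↪g G)

/-- Given an embedded copy of the forcer via the vertex map `f`, one of its two
constituent paths has all its vertices in `S`. -/
def ConstituentPathIn (f : Fin 8 → V) (S : Set V) : Prop :=
  (∀ i : Fin 8, i.val < 4 → f i ∈ S) ∨ (∀ i : Fin 8, 4 ≤ i.val → f i ∈ S)

/-- `X` is a homogeneous set of `H`. -/
def IsHomogeneousSet {W : Type*} (H : SimpleGraph W) (X : Set W) : Prop :=
  ∀ v ∉ X, (∀ x ∈ X, H.Adj v x) ∨ (∀ x ∈ X, ¬ H.Adj v x)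

/-- `H` is guarded: for each forcer in `H` there is a proper homogeneous set
containing a constituent path of the forcer. -/
def Guarded {W : Type*} (H : SimpleGraph W) : Prop :=
  ∀ f : forcer ↪g H, ∃ X : Set W,
    X ≠ Set.univ ∧ IsHomogeneousSet H X ∧ ConstituentPathIn (fun i => f i) X

/-- The house: the complement of the five-vertex path. -/
def house : SimpleGraph (Fin 5) := (SimpleGraph.pathGraph 5)ᶜ

def HouseFree (G : SimpleGraph V) : Prop := IsEmpty (house ↪g G)

/-- `g` is a good function on the induced subgraph `G[X]`. -/
def GoodOnSub [Fintype V] (G : SimpleGraph V) (X : Set V) (g : V → ℝ) : Prop :=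
  (∀ v ∈ X, 0 ≤ g v) ∧
  ∀ S : Finset V, (S : Set V) ⊆ X → IsPerfect (G.induce (S : Set V)) →
    ∑ v ∈ S, g v ≤ 1


/-! ### Connected sets -/

theorem ConnSet.subset_of_closed {G : SimpleGraph V} {S T : Set V} (h : ConnSet G S) {s : V}
    (hs : s ∈ S) (hsT : s ∈ T) (hcl : ∀ a ∈ S, a ∈ T → ∀ b ∈ S, G.Adj a b → b ∈ T) : S ⊆ T := by
  intro b hb
  obtain ⟨p⟩ := h.preconnected ⟨s, hs⟩ ⟨b, hb⟩
  have key : ∀ (u v : S), (G.induce S).Walk u v → (u : V) ∈ T → (v : V) ∈ T := by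
    intro u v p
    induction p with
    | nil => exact id
    | cons hadj _ ih =>
      exact fun hu => ih (hcl _ (Subtype.coe_prop _) hu _ (Subtype.coe_prop _) hadj)
  exact key _ _ p hsT

theorem ConnSet.nonempty {G : SimpleGraph V} {S : Set V} (h : ConnSet G S) : S.Nonempty :=
  Set.nonempty_coe_sort.mp (SimpleGraph.Connected.nonempty h)

/-- A connected set meeting both `T` and its complement has an edge leaving `T`. -/
theorem ConnSet.exists_adj_of_not_subset {G : SimpleGraph V} {S T : Set V} (h : ConnSet G S)
    {s : V} (hs : s ∈ S) (hsT : s ∈ T) (hST : ¬ S ⊆ T) :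
    ∃ a ∈ S, a ∈ T ∧ ∃ b ∈ S, b ∉ T ∧ G.Adj a b := by
  by_contra hcon
  push Not at hcon
  refine hST (h.subset_of_closed hs hsT fun a ha haT b hb hab => ?_)
  by_contra hbT
  exact hcon a ha haT b hb hbT hab

theorem connSet_of_closed {G : SimpleGraph V} {S : Set V} {s : V} (hs : s ∈ S)
    (h : ∀ T : Set V, s ∈ T → (∀ a ∈ S, a ∈ T → ∀ b ∈ S, G.Adj a b → b ∈ T) → S ⊆ T) :
    ConnSet G S := by
  have key := h {v | ∃ hv : v ∈ S, (G.induce S).Reachable ⟨s, hs⟩ ⟨v, hv⟩}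
    ⟨hs, SimpleGraph.Reachable.refl _⟩ (by
      rintro a ha ⟨_, hra⟩ b hb hab
      refine ⟨hb, hra.trans (SimpleGraph.Adj.reachable ?_)⟩
      simpa using hab)
  have : Nonempty S := ⟨⟨s, hs⟩⟩
  refine SimpleGraph.Connected.mk ?_
  rintro ⟨u, hu⟩ ⟨v, hv⟩
  obtain ⟨_, h1⟩ := key hu
  obtain ⟨_, h2⟩ := key hv
  exact h1.symm.trans h2

theorem ConnSet.union {G : SimpleGraph V} {S T : Set V} (hS : ConnSet G S) (hT : ConnSet G T)
    {a b : V} (ha : a ∈ S) (hb : b ∈ T) (hab : a = b ∨ G.Adj a b) : ConnSet G (S ∪ T) := by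
  refine connSet_of_closed (Or.inl ha) fun U haU hcl => ?_
  have hSU : S ⊆ U := hS.subset_of_closed ha haU
    fun x hx hxU y hy hxy => hcl x (Or.inl hx) hxU y (Or.inl hy) hxy
  have hbU : b ∈ U := by
    rcases hab with rfl | hab
    · exact haU
    · exact hcl a (Or.inl ha) haU b (Or.inr hb) hab
  exact Set.union_subset hSU (hT.subset_of_closed hb hbU
    fun x hx hxU y hy hxy => hcl x (Or.inr hx) hxU y (Or.inr hy) hxy)

theorem connSet_singleton (G : SimpleGraph V) (v : V) : ConnSet G {v} :=
  connSet_of_closed (Set.mem_singleton v) fun T hv _ => by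
    rintro x rfl
    exact hv

theorem ConnSet.insert {G : SimpleGraph V} {S : Set V} (hS : ConnSet G S) {a v : V} (ha : a ∈ S)
    (hav : G.Adj a v) : ConnSet G (S ∪ {v}) :=
  hS.union (connSet_singleton G v) ha rfl (Or.inr hav)

theorem anticonnSet_iff {G : SimpleGraph V} {S : Set V} : AnticonnSet G S ↔ ConnSet Gᶜ S := by
  have : (G.induce S)ᶜ = Gᶜ.induce S := by
    ext u v
    simp [Subtype.ext_iff]
  rw [AnticonnSet, ConnSet, this]

/-! ### Components -/

theorem IsCompOf.mem_of_adj {G : SimpleGraph V} {X Y : Set V} (h : IsCompOf G X Y) {a v : V}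
    (ha : a ∈ Y) (hv : v ∈ X) (hav : G.Adj a v) : v ∈ Y := by
  have := h.2.2 (Y ∪ {v}) Set.subset_union_left
    (Set.union_subset h.1 (Set.singleton_subset_iff.mpr hv)) (h.2.1.insert ha hav)
  rw [← this]
  exact Or.inr rfl

theorem IsCompOf.subset_of_connSet {G : SimpleGraph V} {X Y S : Set V} (h : IsCompOf G X Y)
    (hS : ConnSet G S) (hSX : S ⊆ X) {s : V} (hs : s ∈ S) (hsY : s ∈ Y) : S ⊆ Y :=
  hS.subset_of_closed hs hsY fun _ _ haY _ hb hab => h.mem_of_adj haY (hSX hb) hab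

theorem isCompOf_of_closed {G : SimpleGraph V} {X Y : Set V} (hYX : Y ⊆ X) (hY : ConnSet G Y)
    (hcl : ∀ a ∈ Y, ∀ b ∈ X, G.Adj a b → b ∈ Y) : IsCompOf G X Y := by
  refine ⟨hYX, hY, fun Z hYZ hZX hZ => ?_⟩
  obtain ⟨y, hy⟩ := hY.nonempty
  exact Set.Subset.antisymm (hZ.subset_of_closed (hYZ hy) hy
    fun a _ haY b hb hab => hcl a haY b (hZX hb) hab) hYZ

theorem exists_isCompOf (G : SimpleGraph V) {X : Set V} {x : V} (hx : x ∈ X) :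
    ∃ Y, IsCompOf G X Y ∧ x ∈ Y := by
  let Y : Set V := {v | Relation.ReflTransGen (fun a b => G.Adj a b ∧ b ∈ X) x v}
  have hxY : x ∈ Y := Relation.ReflTransGen.refl
  refine ⟨Y, isCompOf_of_closed ?_ ?_ ?_, hxY⟩
  · intro v hv
    rcases Relation.ReflTransGen.cases_tail hv with rfl | ⟨_, _, h⟩
    · exact hx
    · exact h.2
  · refine connSet_of_closed hxY fun T hxT hcl v hv => ?_
    induction (hv : Relation.ReflTransGen _ x v) with
    | refl => exact hxT
    | tail hab h ih => exact hcl _ hab ih _ (Relation.ReflTransGen.tail hab h) h.1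
  · exact fun a ha b hb hab => Relation.ReflTransGen.tail ha ⟨hab, hb⟩

theorem IsCompOf.not_adj_of_disjoint {G : SimpleGraph V} {X Y Z : Set V} (hY : IsCompOf G X Y)
    (hZ : IsCompOf G X Z) (hYZ : Disjoint Y Z) {a b : V} (ha : a ∈ Y) (hb : b ∈ Z) :
    ¬ G.Adj a b := fun hab =>
  Set.disjoint_left.mp hYZ (hY.mem_of_adj ha (hZ.1 hb) hab) hb

/-! ### Holes with hats -/

/-- In a graph without a hole with a hat, if `x`, `y`, `h` form a triangle, `F` is connected,
`x` and `y` both have neighbours in `F` and `h` has none, then `x` and `y` have a common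
neighbour in `F`. -/
theorem HoleWithHatFree.exists_common_adj {G : SimpleGraph V} (hG : HoleWithHatFree G)
    {F : Set V} (hF : ConnSet G F) {x y h : V} (hxy : G.Adj x y) (hhx : G.Adj h x)
    (hhy : G.Adj h y) (hh : ∀ f ∈ F, ¬ G.Adj h f) (hx : ∃ f ∈ F, G.Adj x f)
    (hy : ∃ f ∈ F, G.Adj y f) : ∃ f ∈ F, G.Adj x f ∧ G.Adj y f := by
  by_contra hcon
  push Not at hcon
  obtain ⟨fx, hfx, hxfx⟩ := hx
  obtain ⟨fy, hfy, hyfy⟩ := hy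
  have hxF : x ∉ F := fun hm => hh x hm hhx
  have hyF : y ∉ F := fun hm => hh y hm hhy
  have hhF : h ∉ F := fun hm => hcon h hm hhx.symm hhy.symm
  -- the subgraph induced on `F ∪ {x, y}` with the edge `xy` removed
  let H : SimpleGraph V :=
    { Adj := fun u v => G.Adj u v ∧ (u ∈ F ∨ v ∈ F) ∧ (u ∈ F ∨ u = x ∨ u = y) ∧
        (v ∈ F ∨ v = x ∨ v = y)
      symm := ⟨fun u v h => ⟨h.1.symm, h.2.1.symm, h.2.2.2, h.2.2.1⟩⟩
      loopless := ⟨fun u h => G.loopless.irrefl u h.1⟩ }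
  have hHG : ∀ u v, H.Adj u v → G.Adj u v := fun u v h => h.1
  have hHFF : ∀ a ∈ F, ∀ b ∈ F, G.Adj a b → H.Adj a b :=
    fun a ha b hb hab => ⟨hab, Or.inl ha, Or.inl ha, Or.inl hb⟩
  have hHF : F ⊆ {v | H.Reachable fx v} :=
    hF.subset_of_closed hfx (SimpleGraph.Reachable.refl _) fun a ha har b hb hab =>
      SimpleGraph.Reachable.trans har (hHFF a ha b hb hab).reachable
  have hHx : H.Adj x fx := ⟨hxfx, Or.inr hfx, Or.inr (Or.inl rfl), Or.inl hfx⟩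
  have hHy : H.Adj y fy := ⟨hyfy, Or.inr hfy, Or.inr (Or.inr rfl), Or.inl hfy⟩
  have hreach : H.Reachable x y :=
    hHx.reachable.trans ((hHF hfy).trans hHy.symm.reachable)
  obtain ⟨p, hp⟩ := hreach.exists_walk_length_eq_dist
  set k := p.length with hk
  have hmem : ∀ i, p.getVert i ∈ F ∨ p.getVert i = x ∨ p.getVert i = y := by
    intro i
    by_cases hi : i < k
    · exact (p.adj_getVert_succ hi).2.2.1
    · right; right
      exact p.getVert_of_length_le (by omega)
  have hdist : ∀ i ≤ k, H.dist x (p.getVert i) = i := by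
    intro i hi
    have h1 : H.dist x (p.getVert i) ≤ i := by
      refine (SimpleGraph.dist_le (p.take i)).trans ?_
      simp
    have h2 : H.dist (p.getVert i) y ≤ k - i := by
      refine (SimpleGraph.dist_le (p.drop i)).trans ?_
      simp [hk]
    have h3 : H.dist x y ≤ H.dist x (p.getVert i) + H.dist (p.getVert i) y := by
      have hr : H.Reachable x (p.getVert i) := (p.take i).reachable
      exact hr.dist_triangle_left _
    omega
  have hinj : ∀ i ≤ k, ∀ j ≤ k, p.getVert i = p.getVert j → i = j := by
    intro i hi j hj hij
    rw [← hdist i hi, ← hdist j hj, hij]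
  have h0 : p.getVert 0 = x := p.getVert_zero
  have hl : p.getVert k = y := p.getVert_length
  have hadjH : ∀ i ≤ k, ∀ j ≤ k, H.Adj (p.getVert i) (p.getVert j) → j ≤ i + 1 := by
    intro i hi j hj hij
    have hr : H.Reachable x (p.getVert i) := (p.take i).reachable
    have := hr.dist_triangle_left (p.getVert j)
    rw [hdist i hi, hdist j hj, SimpleGraph.dist_eq_one_iff_adj.mpr hij] at this
    exact this
  have hk0 : k ≠ 0 := by
    intro h
    rw [h] at hl
    exact hxy.ne (h0.symm.trans hl)
  have hk1 : k ≠ 1 := by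
    intro h
    have := p.adj_getVert_succ (i := 0) (by omega)
    rw [h0, show 0 + 1 = k by omega, hl] at this
    exact this.2.1.elim hxF hyF
  have hk2 : k ≠ 2 := by
    intro h
    have h1 := p.adj_getVert_succ (i := 0) (by omega)
    have h2 := p.adj_getVert_succ (i := 1) (by omega)
    rw [show 1 + 1 = k by omega, hl] at h2
    rw [h0] at h1
    exact hcon _ (h1.2.1.resolve_left hxF) h1.1 h2.1.symm
  have hint : ∀ i, 0 < i → i < k → p.getVert i ∈ F := by
    intro i hi hik
    rcases hmem i with h | h | h
    · exact h
    · exact absurd (hinj i hik.le 0 (by omega) (h.trans h0.symm)) (by omega)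
    · exact absurd (hinj i hik.le k le_rfl (h.trans hl.symm)) (by omega)
  have hadjG : ∀ i ≤ k, ∀ j ≤ k, i < j →
      (G.Adj (p.getVert i) (p.getVert j) ↔ (j = i + 1 ∨ (i = 0 ∧ j = k))) := by
    intro i hi j hj hij
    constructor
    · intro hadj
      by_cases hc : i = 0 ∧ j = k
      · exact Or.inr hc
      · left
        have : H.Adj (p.getVert i) (p.getVert j) := by
          refine ⟨hadj, ?_, hmem i, hmem j⟩
          by_cases hi0 : i = 0
          · exact Or.inr (hint j (by omega) (by omega))
          · exact Or.inl (hint i (by omega) (by omega))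
        have := hadjH i hi j hj this
        omega
    · rintro (rfl | ⟨rfl, rfl⟩)
      · exact hHG _ _ (p.adj_getVert_succ (by omega))
      · rw [h0, hl]
        exact hxy
  have : NeZero (k + 1) := ⟨by omega⟩
  have : Fact (1 < k + 1) := ⟨by omega⟩
  have hvle : ∀ i : ZMod (k + 1), i.val ≤ k := fun i => Nat.lt_succ_iff.mp (ZMod.val_lt i)
  have hsucc : ∀ i j : ZMod (k + 1), i - j = 1 ↔
      (i.val = j.val + 1 ∨ (j.val = k ∧ i.val = 0)) := by
    intro i j
    rw [sub_eq_iff_eq_add', ← (ZMod.val_injective (k + 1)).eq_iff, ZMod.val_add, ZMod.val_one]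
    have h1 := hvle i
    have h2 := hvle j
    by_cases hj : j.val = k
    · rw [hj, Nat.mod_self]
      omega
    · rw [Nat.mod_eq_of_lt (by omega)]
      omega
  refine hG ⟨k + 1, fun i => p.getVert i.val, h, (k : ZMod (k + 1)),
    ⟨by omega, ?_, ?_⟩, ?_, ?_⟩
  · intro i j hij
    exact ZMod.val_injective _ (hinj _ (hvle i) _ (hvle j) hij)
  · intro i j
    have h1 := hvle i
    have h2 := hvle j
    rw [hsucc, hsucc]
    rcases lt_trichotomy i.val j.val with hlt | heq | hgt
    · rw [hadjG _ h1 _ h2 hlt]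
      omega
    · have : ¬ G.Adj (p.getVert i.val) (p.getVert j.val) := by
        rw [heq]
        exact G.loopless.irrefl _
      simp only [this, false_iff]
      omega
    · rw [G.adj_comm, hadjG _ h2 _ h1 hgt]
      omega
  · intro j hj
    rcases hmem j.val with hm | hm | hm
    · exact hhF (hj ▸ hm)
    · exact hhx.ne (hj.trans hm)
    · exact hhy.ne (hj.trans hm)
  · intro j
    have hkval : ((k : ZMod (k + 1))).val = k := ZMod.val_cast_of_lt (by omega)
    have e1 : j = (k : ZMod (k + 1)) ↔ j.val = k := by
      rw [← (ZMod.val_injective (k + 1)).eq_iff, hkval]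
    have e2 : j = (k : ZMod (k + 1)) + 1 ↔ j.val = 0 := by
      have : (k : ZMod (k + 1)) + 1 = 0 := by
        have := ZMod.natCast_self (k + 1)
        push_cast at this
        exact this
      rw [this, ZMod.val_eq_zero]
    rw [e1, e2]
    have hj := hvle j
    constructor
    · intro hadj
      by_contra hne
      exact hh _ (hint j.val (by omega) (by omega)) hadj
    · rintro (hj | hj)
      · simp only [hj, hl]
        exact hhy
      · simp only [hj, h0]
        exact hhx

/-- A four-cycle `a b c d` has no hat adjacent to `a` and `b`. -/
theorem HoleWithHatFree.not_hat_of_four_cycle {G : SimpleGraph V} (hG : HoleWithHatFree G)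
    {a b c d h : V} (hab : G.Adj a b) (hbc : G.Adj b c) (hcd : G.Adj c d) (hda : G.Adj d a)
    (hac : ¬ G.Adj a c) (hbd : ¬ G.Adj b d) (hha : G.Adj h a) (hhb : G.Adj h b)
    (hhc : ¬ G.Adj h c) (hhd : ¬ G.Adj h d) : False := by
  obtain ⟨f, hf, haf, hbf⟩ := hG.exists_common_adj
    ((connSet_singleton G c).insert rfl hcd) hab hha hhb
    (by rintro f (rfl | rfl) <;> assumption) ⟨d, Or.inr rfl, hda.symm⟩ ⟨c, Or.inl rfl, hbc⟩
  rcases hf with rfl | rfl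
  · exact hac haf
  · exact hbd hbf

/-- If a vertex `a` has both a neighbour and a non-neighbour in the anticonnected set `C`, and
`p`, `q` are nonadjacent vertices complete to `C`, then `a` is adjacent to `q` whenever it is
adjacent to `p`. -/
theorem HoleWithHatFree.adj_of_mixedOn {G : SimpleGraph V} (hG : HoleWithHatFree G) {C : Set V}
    (hC : AnticonnSet G C) {a p q : V} (ha : MixedOn G a C) (hp : VertCompleteTo G p C)
    (hq : VertCompleteTo G q C) (hpq : ¬ G.Adj p q) (hap : G.Adj a p) : G.Adj a q := by
  by_contra haq
  obtain ⟨⟨c₀, hc₀, hac₀⟩, ⟨c₁, hc₁, hac₁⟩⟩ := ha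
  obtain ⟨c, hc, hac, c', hc', hac', hcc⟩ :=
    (anticonnSet_iff.mp hC).exists_adj_of_not_subset (T := {c | G.Adj a c}) hc₀ hac₀
      fun h => hac₁ (h hc₁)
  rw [SimpleGraph.compl_adj] at hcc
  exact hG.not_hat_of_four_cycle (hp c hc).symm (hp c' hc') (hq c' hc').symm (hq c hc)
    hcc.2 hpq hac hap hac' haq

/-- If `C` and `K` are connected, no vertex of `K` is complete to `C`, and `x` is a vertex
complete to `C` with a neighbour in `K`, then some neighbour of `x` in `K` has a neighbour in `C`,
provided some vertex of `K` has one. -/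
theorem HoleWithHatFree.exists_adj_of_vertCompleteTo {G : SimpleGraph V} (hG : HoleWithHatFree G)
    {C K : Set V} (hC : ConnSet G C) (hK : ConnSet G K) {x a k : V} (hx : VertCompleteTo G x C)
    (hKC : ∀ v ∈ K, ¬ VertCompleteTo G v C) (ha : a ∈ K) (hax : G.Adj a x) (hk : k ∈ K)
    (hkC : ∃ c ∈ C, G.Adj k c) : ∃ v ∈ K, G.Adj v x ∧ ∃ c ∈ C, G.Adj v c := by
  by_contra hcon
  have haC : ¬ ∃ c ∈ C, G.Adj a c := fun h => hcon ⟨a, ha, hax, h⟩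
  obtain ⟨T, hT, haT⟩ := exists_isCompOf G (X := {v | v ∈ K ∧ ¬ ∃ c ∈ C, G.Adj v c}) ⟨ha, haC⟩
  obtain ⟨t, -, htT, b, hb, hbT, htb⟩ :=
    hK.exists_adj_of_not_subset ha haT fun h => (hT.1 (h hk)).2 hkC
  have hbC : ∃ c ∈ C, G.Adj b c := by
    by_contra hbC
    exact hbT (hT.mem_of_adj htT ⟨hb, hbC⟩ htb)
  have hbx : ¬ G.Adj b x := fun h => hcon ⟨b, hb, h, hbC⟩
  obtain ⟨c₀, hc₀, hbc₀⟩ := hbC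
  obtain ⟨c, hc, hbc, c', hc', hbc', hcc⟩ :=
    hC.exists_adj_of_not_subset (T := {c | G.Adj b c}) hc₀ hbc₀ fun h => hKC b hb h
  obtain ⟨f, hf, hxf, hcf⟩ := hG.exists_common_adj (hT.2.1.insert htT htb) (hx c hc)
    (hx c' hc').symm hcc.symm (by
      rintro f (hf | rfl) hcf
      · exact (hT.1 hf).2 ⟨c', hc', hcf.symm⟩
      · exact hbc' hcf.symm) ⟨a, Or.inl haT, hax.symm⟩ ⟨b, Or.inr rfl, hbc.symm⟩
  rcases hf with hf | rfl
  · exact (hT.1 hf).2 ⟨c, hc, hcf.symm⟩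
  · exact hbx hxf.symm

/-- A forbidden configuration: a four-cycle `z z' x a` and a connected set `Y` to which `a` is
anticomplete, such that `z` and `z'` have neighbours in `Y` and a common neighbour `c` with no
neighbour in `Y`, and some neighbour of `z` in `Y` is not adjacent to `x`. -/
theorem HoleWithHatFree.false_of_four_cycle_of_connSet {G : SimpleGraph V}
    (hG : HoleWithHatFree G) {Y : Set V} (hY : ConnSet G Y) {a c x y z z' : V}
    (hzz' : G.Adj z z') (hz'x : G.Adj z' x) (hxa : G.Adj x a) (haz : G.Adj a z)
    (hzx : ¬ G.Adj z x) (hz'a : ¬ G.Adj z' a) (haY : ∀ v ∈ Y, ¬ G.Adj v a)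
    (hcz : G.Adj c z) (hcz' : G.Adj c z') (hcY : ∀ v ∈ Y, ¬ G.Adj c v)
    (hy : y ∈ Y) (hzy : G.Adj z y) (hyx : ¬ G.Adj y x) (hz'Y : ∃ v ∈ Y, G.Adj z' v) : False := by
  have hcom : ∀ v ∈ Y, G.Adj z v → G.Adj z' v → G.Adj v x := by
    intro v hv hzv hz'v
    by_contra hvx
    exact hG.not_hat_of_four_cycle hzz' hz'x hxa haz hzx hz'a hzv.symm hz'v.symm hvx (haY v hv)
  have hprop : ∀ r ∈ Y, ∀ r' ∈ Y, G.Adj z r → G.Adj z r' → G.Adj r r' → G.Adj r x →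
      G.Adj r' x := by
    intro r hr r' hr' hzr hzr' hrr' hrx
    by_contra hr'x
    exact hG.not_hat_of_four_cycle hzr hrx hxa haz hzx (haY r hr) hzr'.symm hrr'.symm hr'x
      (haY r' hr')
  let R : V → V → Prop := fun r r' => (r' ∈ Y ∧ G.Adj z r') ∧ G.Adj r r'
  let S : Set V := {s | ∃ v ∈ Y, G.Adj z v ∧ G.Adj z' v ∧ Relation.ReflTransGen R v s}
  have hS : ∀ s ∈ S, s ∈ Y ∧ G.Adj z s ∧ G.Adj s x := by
    rintro s ⟨v, hv, hzv, hz'v, hvs⟩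
    induction hvs with
    | refl => exact ⟨hv, hzv, hcom v hv hzv hz'v⟩
    | tail _ h ih => exact ⟨h.1.1, h.1.2, hprop _ ih.1 _ h.1.1 ih.2.1 h.1.2 h.2 ih.2.2⟩
  have hScl : ∀ s ∈ S, ∀ f ∈ Y, G.Adj z f → G.Adj s f → f ∈ S := by
    rintro s ⟨v, hv, hzv, hz'v, hvs⟩ f hf hzf hsf
    exact ⟨v, hv, hzv, hz'v, hvs.tail ⟨⟨hf, hzf⟩, hsf⟩⟩
  have hSz' : ∀ f ∈ Y, G.Adj z f → G.Adj z' f → f ∈ S :=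
    fun f hf hzf hz'f => ⟨f, hf, hzf, hz'f, Relation.ReflTransGen.refl⟩
  have hyS : y ∉ S := fun h => hyx (hS y h).2.2
  obtain ⟨s₀, hs₀, hzs₀, hz's₀⟩ :=
    hG.exists_common_adj hY hzz' hcz hcz' hcY ⟨y, hy, hzy⟩ hz'Y
  have hs₀S : s₀ ∈ S := hSz' s₀ hs₀ hzs₀ hz's₀
  obtain ⟨F, hF, hyF⟩ := exists_isCompOf G (X := Y \ S) ⟨hy, hyS⟩
  have hFY : ∀ f ∈ F, f ∈ Y := fun f hf => (hF.1 hf).1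
  have hFS : ∀ f ∈ F, f ∉ S := fun f hf => (hF.1 hf).2
  obtain ⟨f₀, -, hf₀F, s, hs, hsF, hf₀s⟩ :=
    hY.exists_adj_of_not_subset hy hyF fun h => hFS _ (h hs₀) hs₀S
  have hsS : s ∈ S := by
    by_contra hsS
    exact hsF (hF.mem_of_adj hf₀F ⟨hs, hsS⟩ hf₀s)
  obtain ⟨v, hv, hzv, hz'v, hvs⟩ := hsS
  have hvS : v ∈ S := hSz' v hv hzv hz'v
  have hback : (∃ f ∈ F, G.Adj s f) → ∃ f ∈ F, G.Adj v f := by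
    clear hs hsF hf₀s
    induction hvs with
    | refl => exact id
    | @tail r r' hvr h ih =>
      intro hr'F
      refine ih ?_
      by_contra hrF
      push Not at hrF
      have hrS : r ∈ S := ⟨v, hv, hzv, hz'v, hvr⟩
      have hr'S : r' ∈ S := hScl r hrS r' h.1.1 h.1.2 h.2
      obtain ⟨f, hf, hzf, hr'f⟩ := hG.exists_common_adj hF.2.1 h.1.2 (hS r hrS).2.1.symm h.2 hrF
        ⟨y, hyF, hzy⟩ hr'F
      exact hFS f hf (hScl r' hr'S f (hFY f hf) hzf hr'f)
  have hvF := hback ⟨f₀, hf₀F, hf₀s.symm⟩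
  by_cases hz'F : ∃ f ∈ F, G.Adj z' f
  · obtain ⟨f, hf, hzf, hz'f⟩ := hG.exists_common_adj hF.2.1 hzz' hcz hcz'
      (fun f hf => hcY f (hFY f hf)) ⟨y, hyF, hzy⟩ hz'F
    exact hFS f hf (hSz' f (hFY f hf) hzf hz'f)
  · push Not at hz'F
    obtain ⟨f, hf, hzf, hvf⟩ := hG.exists_common_adj hF.2.1 hzv hzz'.symm hz'v hz'F
      ⟨y, hyF, hzy⟩ hvF
    exact hFS f hf (hScl v hvS f (hFY f hf) hzf hvf)

/-! ### Weights -/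

theorem setSum_mono [Fintype V] {w : V → ℝ} (hw : IsWeight w) {A B : Set V} (h : A ⊆ B) :
    setSum w A ≤ setSum w B :=
  Finset.sum_le_sum fun v _ => Set.indicator_le_indicator_of_subset h hw.1 v

theorem setSum_union_of_disjoint [Fintype V] (w : V → ℝ) {A B : Set V} (h : Disjoint A B) :
    setSum w (A ∪ B) = setSum w A + setSum w B := by
  simp only [setSum, ← Finset.sum_add_distrib, Set.indicator_union_of_disjoint h]

theorem setSum_add_setSum_diff [Fintype V] (w : V → ℝ) {A B : Set V} (h : A ⊆ B) :
    setSum w A + setSum w (B \ A) = setSum w B := by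
  rw [← setSum_union_of_disjoint w Set.disjoint_sdiff_right, Set.union_sdiff_cancel h]

theorem setSum_univ [Fintype V] {w : V → ℝ} (hw : IsWeight w) : setSum w Set.univ = 1 := by
  simp [setSum, hw.2]

theorem setSum_add_setSum_compl [Fintype V] {w : V → ℝ} (hw : IsWeight w) (A : Set V) :
    setSum w A + setSum w Aᶜ = 1 := by
  rw [← setSum_univ hw, ← setSum_add_setSum_diff w (Set.subset_univ A), Set.compl_eq_univ_sdiff]

theorem setSum_union_le [Fintype V] {w : V → ℝ} (hw : IsWeight w) (A B : Set V) :
    setSum w (A ∪ B) ≤ setSum w A + setSum w B := by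
  rw [← Set.union_sdiff_self, setSum_union_of_disjoint w Set.disjoint_sdiff_right]
  gcongr
  exact setSum_mono hw Set.sdiff_subset

theorem setSum_empty [Fintype V] (w : V → ℝ) : setSum w ∅ = 0 := by
  simp [setSum]

theorem Coherent.exists_isBigComp [Fintype V] {G : SimpleGraph V} {w : V → ℝ} {ε : ℝ}
    (hcoh : Coherent G w ε) (hε : 0 < ε) {X : Set V} (hX : 3 * ε ≤ setSum w X) :
    ∃ Y, IsBigComp G w ε X Y := by
  let 𝒰 : Set (Set V) :=
    {U | U ⊆ X ∧ (∀ a ∈ U, ∀ b ∈ X, G.Adj a b → b ∈ U) ∧ setSum w X - ε < setSum w U}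
  obtain ⟨U, hU⟩ := (Set.toFinite 𝒰).exists_minimal
    ⟨X, Set.Subset.rfl, fun _ _ b hb _ => hb, by linarith⟩
  obtain ⟨hUX, hUcl, hUw⟩ := hU.prop
  have hsmall : ∀ W ⊆ U, W ≠ U → (∀ a ∈ W, ∀ b ∈ X, G.Adj a b → b ∈ W) → setSum w W < ε := by
    intro W hWU hne hWcl
    have hWw : setSum w W ≤ setSum w X - ε := by
      by_contra hlt
      exact hne (hWU.antisymm (hU.le_of_le ⟨hWU.trans hUX, hWcl, not_le.mp hlt⟩ hWU))
    have h1 := setSum_add_setSum_diff w (hWU.trans hUX)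
    have h2 := hcoh.2.2 W (X \ W) Set.disjoint_sdiff_right
      fun a ha b hb hab => hb.2 (hWcl a ha b hb.1 hab)
    rcases min_lt_iff.mp h2 with h | h
    · exact h
    · linarith
  have hne : U.Nonempty := by
    by_contra h
    rw [Set.not_nonempty_iff_eq_empty] at h
    rw [h, setSum_empty] at hUw
    linarith
  obtain ⟨s, hs⟩ := hne
  refine ⟨U, isCompOf_of_closed hUX (connSet_of_closed hs fun T hsT hT => ?_) hUcl, hUw⟩
  by_contra hUT
  have h1 := hsmall (U ∩ T) Set.inter_subset_left (fun h => hUT (Set.inter_eq_left.mp h))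
    fun a ha b hb hab =>
      have hbU := hUcl a ha.1 b hb hab
      ⟨hbU, hT a ha.1 ha.2 b hbU hab⟩
  have h2 := hsmall (U \ T) Set.sdiff_subset
    (fun h => (h.symm ▸ hs : s ∈ U \ T).2 hsT)
    fun a ha b hb hab =>
      have hbU := hUcl a ha.1 b hb hab
      ⟨hbU, fun hbT => ha.2 (hT b hbU hbT a ha.1 hab.symm)⟩
  have h3 := setSum_add_setSum_diff w (Set.inter_subset_left (s := U) (t := T))
  rw [Set.sdiff_self_inter] at h3
  linarith

/-! ### Splits -/

theorem Coherent.lt_setSum_compl [Fintype V] {G : SimpleGraph V} {w : V → ℝ} {ε : ℝ}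
    (hcoh : Coherent G w ε) (hw : IsWeight w) {C D : Set V} (hC : C.Nonempty) (hD : D.Nonempty)
    (hDC : ∀ d ∈ D, VertCompleteTo G d C) : 1 - 2 * ε < setSum w (C ∪ D)ᶜ := by
  obtain ⟨c, hc⟩ := hC
  obtain ⟨d, hd⟩ := hD
  have h1 : setSum w C < ε :=
    (setSum_mono hw fun v hv => hDC d hd v hv).trans_lt (hcoh.2.1 d)
  have h2 : setSum w D < ε :=
    (setSum_mono hw fun v hv => (hDC v hv c hc).symm).trans_lt (hcoh.2.1 c)
  have h3 := setSum_union_le hw C D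
  have h4 := setSum_add_setSum_compl hw (C ∪ D)
  linarith

theorem inter_nonempty_of_lt_setSum [Fintype V] {w : V → ℝ} (hw : IsWeight w) {A B : Set V}
    (h : 1 < setSum w A + setSum w B) : (A ∩ B).Nonempty := by
  by_contra hne
  rw [Set.not_nonempty_iff_eq_empty, ← Set.disjoint_iff_inter_eq_empty] at hne
  have h1 := setSum_mono hw (Set.subset_univ (A ∪ B))
  rw [setSum_union_of_disjoint w hne, setSum_univ hw] at h1
  linarith

theorem IsSplit.vertCompleteTo [Fintype V] {G : SimpleGraph V} {w : V → ℝ} {ε : ℝ} {C D : Set V}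
    (h : IsSplit G w ε C D) {d : V} (hd : d ∈ D) : VertCompleteTo G d C := by
  rw [h.2.2.2.2.2.1] at hd
  exact hd.2

theorem IsSplit.lt_setSum_compl [Fintype V] {G : SimpleGraph V} {w : V → ℝ} {ε : ℝ} {C D : Set V}
    (h : IsSplit G w ε C D) (hcoh : Coherent G w ε) (hw : IsWeight w) :
    1 - 2 * ε < setSum w (C ∪ D)ᶜ :=
  hcoh.lt_setSum_compl hw h.2.2.1.nonempty h.2.2.2.2.1 fun _ hd => h.vertCompleteTo hd

/-- `(C, D)` is an optimal split, `Y` is the big component of `G \ (C ∪ D)`, and `K` is a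
component of `G \ (C ∪ D)` with an attachment in `C`. -/
def IsPiece [Fintype V] (G : SimpleGraph V) (w : V → ℝ) (ε : ℝ) (C D Y K : Set V) : Prop :=
  IsOptimalSplit G w ε C D ∧ IsBigComp G w ε (C ∪ D)ᶜ Y ∧ IsCompOf G (C ∪ D)ᶜ K ∧
    ∃ c ∈ C, IsAttachment G K c

namespace IsPiece

theorem isSplit [Fintype V] {G : SimpleGraph V} {w : V → ℝ} {ε : ℝ} {C D Y K : Set V}
    (h : IsPiece G w ε C D Y K) : IsSplit G w ε C D := h.1.1

theorem connSet_left [Fintype V] {G : SimpleGraph V} {w : V → ℝ} {ε : ℝ} {C D Y K : Set V}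
    (h : IsPiece G w ε C D Y K) : ConnSet G C := h.isSplit.2.2.1

theorem anticonnSet_left [Fintype V] {G : SimpleGraph V} {w : V → ℝ} {ε : ℝ} {C D Y K : Set V}
    (h : IsPiece G w ε C D Y K) : AnticonnSet G C := h.isSplit.2.2.2.1

theorem connSet_big [Fintype V] {G : SimpleGraph V} {w : V → ℝ} {ε : ℝ} {C D Y K : Set V}
    (h : IsPiece G w ε C D Y K) : ConnSet G Y := h.2.1.1.2.1

theorem connSet [Fintype V] {G : SimpleGraph V} {w : V → ℝ} {ε : ℝ} {C D Y K : Set V}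
    (h : IsPiece G w ε C D Y K) : ConnSet G K := h.2.2.1.2.1

theorem notMem_left [Fintype V] {G : SimpleGraph V} {w : V → ℝ} {ε : ℝ} {C D Y K : Set V}
    (h : IsPiece G w ε C D Y K) {a : V} (ha : a ∈ K) : a ∉ C :=
  fun hC => h.2.2.1.1 ha (Or.inl hC)

theorem not_vertCompleteTo [Fintype V] {G : SimpleGraph V} {w : V → ℝ} {ε : ℝ} {C D Y K : Set V}
    (h : IsPiece G w ε C D Y K) {a : V} (ha : a ∈ K) : ¬ VertCompleteTo G a C := by
  intro haC
  refine h.2.2.1.1 ha (Or.inr ?_)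
  rw [h.isSplit.2.2.2.2.2.1]
  exact ⟨h.notMem_left ha, haC⟩

theorem vertCompleteTo [Fintype V] {G : SimpleGraph V} {w : V → ℝ} {ε : ℝ} {C D Y K : Set V}
    (h : IsPiece G w ε C D Y K) {d : V} (hd : d ∈ D) : VertCompleteTo G d C :=
  h.isSplit.vertCompleteTo hd

theorem not_adj_left_big [Fintype V] {G : SimpleGraph V} {w : V → ℝ} {ε : ℝ} {C D Y K : Set V}
    (h : IsPiece G w ε C D Y K) {c y : V} (hc : c ∈ C) (hy : y ∈ Y) : ¬ G.Adj c y :=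
  fun hcy => h.isSplit.2.2.2.2.2.2 Y h.2.1 c hc
    ⟨fun hcY => h.2.1.1.1 hcY (Or.inl hc), y, hy, hcy⟩

theorem disjoint_big [Fintype V] {G : SimpleGraph V} {w : V → ℝ} {ε : ℝ} {C D Y K : Set V}
    (h : IsPiece G w ε C D Y K) : Disjoint K Y := by
  rw [Set.disjoint_left]
  intro v hvK hvY
  obtain ⟨c, hc, -, a, ha, hca⟩ := h.2.2.2
  exact h.not_adj_left_big hc (h.2.1.1.subset_of_connSet h.connSet h.2.2.1.1 hvK hvY ha) hca

theorem not_adj_big [Fintype V] {G : SimpleGraph V} {w : V → ℝ} {ε : ℝ} {C D Y K : Set V}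
    (h : IsPiece G w ε C D Y K) {a y : V} (ha : a ∈ K) (hy : y ∈ Y) : ¬ G.Adj a y :=
  h.2.2.1.not_adj_of_disjoint h.2.1.1 h.disjoint_big ha hy

theorem mem_right_of_adj_big [Fintype V] {G : SimpleGraph V} {w : V → ℝ} {ε : ℝ} {C D Y K : Set V}
    (h : IsPiece G w ε C D Y K) {y v : V} (hy : y ∈ Y) (hv : v ∉ Y) (hyv : G.Adj y v) :
    v ∈ D := by
  by_contra hD
  refine hv (h.2.1.1.mem_of_adj hy (fun hCD => ?_) hyv)
  exact h.not_adj_left_big (hCD.resolve_right hD) hy hyv.symm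

theorem mem_right_of_adj [Fintype V] {G : SimpleGraph V} {w : V → ℝ} {ε : ℝ} {C D Y K : Set V}
    (h : IsPiece G w ε C D Y K) {a v : V} (ha : a ∈ K) (hv : v ∉ K) (hvC : v ∉ C)
    (hav : G.Adj a v) : v ∈ D := by
  by_contra hD
  exact hv (h.2.2.1.mem_of_adj ha (fun hCD => hCD.elim hvC hD) hav)

theorem lt_setSum_big [Fintype V] {G : SimpleGraph V} {w : V → ℝ} {ε : ℝ} {C D Y K : Set V}
    (h : IsPiece G w ε C D Y K) (hcoh : Coherent G w ε) (hw : IsWeight w) :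
    1 - 3 * ε < setSum w Y := by
  have h1 := h.isSplit.lt_setSum_compl hcoh hw
  have h2 := h.2.1.2
  linarith

/-- Optimality: a vertex of `K` that is mixed on `C` and has a neighbour in `D` has a nonneighbour
in `D` with a neighbour in `Y`. -/
theorem exists_not_adj [Fintype V] {G : SimpleGraph V} {w : V → ℝ} {ε : ℝ} {C D Y K : Set V}
    (h : IsPiece G w ε C D Y K) (hcoh : Coherent G w ε) (hw : IsWeight w) (h6 : 6 * ε ≤ 1)
    {a z : V} (ha : a ∈ K) (haC : MixedOn G a C) (hz : z ∈ D) (haz : G.Adj a z) :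
    ∃ z' ∈ D, (∃ v ∈ Y, G.Adj z' v) ∧ ¬ G.Adj z' a := by
  by_contra hcon
  push Not at hcon
  obtain ⟨⟨c, hc, hac⟩, ⟨c', hc', hac'⟩⟩ := haC
  have hmemD : ∀ v, v ∈ D ↔ v ∉ C ∧ VertCompleteTo G v C := fun v => by
    rw [h.isSplit.2.2.2.2.2.1]
    rfl
  let D' : Set V := {v | v ∉ C ∪ {a} ∧ ∀ c ∈ C ∪ {a}, G.Adj v c}
  have hD' : ∀ v ∈ D, G.Adj v a → v ∈ D' := by
    intro v hv hva
    rw [hmemD] at hv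
    refine ⟨fun hvCa => hvCa.elim hv.1 hva.ne, ?_⟩
    rintro u (hu | rfl)
    · exact hv.2 u hu
    · exact hva
  have hzD' : z ∈ D' := hD' z hz haz.symm
  have hconn : ConnSet G (C ∪ {a}) := h.connSet_left.insert hc hac.symm
  have hw' : 1 - 2 * ε < setSum w ((C ∪ {a}) ∪ D')ᶜ :=
    hcoh.lt_setSum_compl hw hconn.nonempty ⟨z, hzD'⟩ fun d hd => hd.2
  have hsplit : IsSplit G w ε (C ∪ {a}) D' := by
    refine ⟨?_, ?_, hconn, ?_, ⟨z, hzD'⟩, rfl, ?_⟩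
    · rw [Set.disjoint_left]
      exact fun v hv hvD => hvD.1 hv
    · exact h.isSplit.2.1.trans (Set.ncard_le_ncard Set.subset_union_left (Set.toFinite _))
    · rw [anticonnSet_iff]
      refine (anticonnSet_iff.mp h.anticonnSet_left).insert hc' ?_
      rw [SimpleGraph.compl_adj]
      refine ⟨?_, fun hadj => hac' hadj.symm⟩
      rintro rfl
      exact h.notMem_left ha hc'
    · rintro Y' hY' u hu ⟨-, v, hv, huv⟩
      have hY'w := hY'.2
      obtain ⟨y, hyY', hyY⟩ := inter_nonempty_of_lt_setSum hw (A := Y') (B := Y)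
        (by linarith [h.lt_setSum_big hcoh hw])
      have hsub : Y' ⊆ Y := hY'.1.2.1.subset_of_closed hyY' hyY fun p _ hpY q hq hpq => by
        by_contra hqY
        have hqD := h.mem_right_of_adj_big hpY hqY hpq
        exact hY'.1.1 hq (Or.inr (hD' q hqD (hcon q hqD ⟨p, hpY, hpq.symm⟩)))
      rcases hu with hu | rfl
      · exact h.not_adj_left_big hu (hsub hv) huv
      · exact h.not_adj_big ha (hsub hv) huv
  have := h.1.2 _ _ hsplit Set.subset_union_left
  exact h.notMem_left ha (this ▸ Or.inr rfl)

theorem subset_of_adj_of_not_subset_big [Fintype V] {G : SimpleGraph V} {w : V → ℝ} {ε : ℝ}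
    (hG : HoleWithHatFree G) (hcoh : Coherent G w ε) (hw : IsWeight w) (h6 : 6 * ε ≤ 1)
    {C₁ D₁ Y₁ K₁ C₂ D₂ Y₂ K₂ : Set V} (h₁ : IsPiece G w ε C₁ D₁ Y₁ K₁)
    (h₂ : IsPiece G w ε C₂ D₂ Y₂ K₂) {u u' : V} (hu : u ∈ K₁) (hu' : u' ∈ K₂)
    (huu' : G.Adj u u') (hY : ¬ Y₂ ⊆ Y₁) : K₂ ⊆ K₁ := by
  by_contra hK
  obtain ⟨y₀, hy₀₂, hy₀₁⟩ := inter_nonempty_of_lt_setSum hw (A := Y₂) (B := Y₁)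
    (by linarith [h₁.lt_setSum_big hcoh hw, h₂.lt_setSum_big hcoh hw])
  obtain ⟨y, hy₂, hy₁, z, hz₂, hz₁, hyz⟩ := h₂.connSet_big.exists_adj_of_not_subset hy₀₂ hy₀₁ hY
  have hzD : z ∈ D₁ := h₁.mem_right_of_adj_big hy₁ hz₁ hyz
  have hCK : ∀ v ∈ K₂, v ∉ C₁ := fun v hv hvC =>
    h₂.not_adj_big hv hz₂ (h₁.vertCompleteTo hzD v hvC).symm
  obtain ⟨a₀, ha₀, x, hx₂, hxD, ha₀x⟩ : ∃ a ∈ K₁, ∃ x ∈ K₂, x ∈ D₁ ∧ G.Adj a x := by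
    by_cases hu'K : u' ∈ K₁
    · obtain ⟨a, -, ha, x, hx, hxK, hax⟩ := h₂.connSet.exists_adj_of_not_subset hu' hu'K hK
      exact ⟨a, ha, x, hx, h₁.mem_right_of_adj ha hxK (hCK x hx) hax, hax⟩
    · exact ⟨u, hu, u', hu', h₁.mem_right_of_adj hu hu'K (hCK u' hu') huu', huu'⟩
  have hxz : ¬ G.Adj x z := h₂.not_adj_big hx₂ hz₂
  have hxC := h₁.vertCompleteTo hxD
  have hzC := h₁.vertCompleteTo hzD
  obtain ⟨c₀, hc₀, -, k, hk, hc₀k⟩ := h₁.2.2.2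
  obtain ⟨a, ha, hax, c, hc, hac⟩ := hG.exists_adj_of_vertCompleteTo h₁.connSet_left h₁.connSet
    hxC (fun v hv => h₁.not_vertCompleteTo hv) ha₀ ha₀x hk ⟨c₀, hc₀, hc₀k.symm⟩
  have hmix : MixedOn G a C₁ := by
    refine ⟨⟨c, hc, hac⟩, ?_⟩
    by_contra hcon
    push Not at hcon
    exact h₁.not_vertCompleteTo ha hcon
  have haz : G.Adj a z := hG.adj_of_mixedOn h₁.anticonnSet_left hmix hxC hzC hxz hax
  obtain ⟨z', hz'D, hz'Y, hz'a⟩ := h₁.exists_not_adj hcoh hw h6 ha hmix hzD haz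
  have hz'C := h₁.vertCompleteTo hz'D
  have hxz' : G.Adj x z' := by
    by_contra hxz'
    exact hz'a (hG.adj_of_mixedOn h₁.anticonnSet_left hmix hxC hz'C hxz' hax).symm
  have hzz' : G.Adj z z' := by
    by_contra hzz'
    exact hz'a (hG.adj_of_mixedOn h₁.anticonnSet_left hmix hzC hz'C hzz' haz).symm
  exact hG.false_of_four_cycle_of_connSet h₁.connSet_big hzz' hxz'.symm hax.symm haz
    (fun h => hxz h.symm) hz'a (fun v hv h => h₁.not_adj_big ha hv h.symm) (hzC c hc).symm
    (hz'C c hc).symm (fun v hv => h₁.not_adj_left_big hc hv) hy₁ hyz.symm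
    (fun h => h₂.not_adj_big hx₂ hy₂ h.symm) hz'Y

/-- Two pieces joined by an edge are nested or have the same big component. -/
theorem subset_or_subset_or_eq [Fintype V] {G : SimpleGraph V} {w : V → ℝ} {ε : ℝ}
    (hG : HoleWithHatFree G) (hcoh : Coherent G w ε) (hw : IsWeight w) (h6 : 6 * ε ≤ 1)
    {C₁ D₁ Y₁ K₁ C₂ D₂ Y₂ K₂ : Set V} (h₁ : IsPiece G w ε C₁ D₁ Y₁ K₁)
    (h₂ : IsPiece G w ε C₂ D₂ Y₂ K₂) {u u' : V} (hu : u ∈ K₁) (hu' : u' ∈ K₂)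
    (huu' : G.Adj u u') : K₁ ⊆ K₂ ∨ K₂ ⊆ K₁ ∨ Y₁ = Y₂ := by
  by_cases h21 : Y₂ ⊆ Y₁
  · by_cases h12 : Y₁ ⊆ Y₂
    · exact Or.inr (Or.inr (h12.antisymm h21))
    · exact Or.inl (subset_of_adj_of_not_subset_big hG hcoh hw h6 h₂ h₁ hu' hu huu'.symm h12)
  · exact Or.inr (Or.inl (subset_of_adj_of_not_subset_big hG hcoh hw h6 h₁ h₂ hu hu' huu' h21))

end IsPiece

theorem statement_13 {V : Type} [Fintype V] (G : SimpleGraph V) (w : V → ℝ) (ε : ℝ)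
    (hε : 0 < ε) (h6 : 6 * ε ≤ 1) (hw : IsWeight w) (hcoh : Coherent G w ε)
    (hG : HoleWithHatFree G) :
    setSum w {v | ∃ A C D B : Set V, IsFracture G w ε A C D B ∧ v ∈ A} < 3 * ε := by
  by_contra hlt
  obtain ⟨U, hU⟩ := hcoh.exists_isBigComp hε (not_lt.mp hlt)
  let P : Set (Set V) := {K | ∃ C D Y, IsPiece G w ε C D Y K}
  have hcover : ∀ v ∈ U, ∃ K, Maximal (· ∈ P) K ∧ v ∈ K := by
    intro v hv
    obtain ⟨A, C, D, B, ⟨hopt, rfl, -⟩, K, hK, hvK, hKC⟩ := hU.1.1 hv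
    obtain ⟨Y, hY⟩ := hcoh.exists_isBigComp hε (X := (C ∪ D)ᶜ)
      (by linarith [hopt.1.lt_setSum_compl hcoh hw])
    obtain ⟨L, hKL, hL⟩ := (Set.toFinite P).exists_le_maximal
      (show K ∈ P from ⟨C, D, Y, hopt, hY, hK, hKC⟩)
    exact ⟨L, hL, hKL hvK⟩
  obtain ⟨u₀, hu₀⟩ := hU.1.2.1.nonempty
  obtain ⟨K₀, hK₀, hu₀K⟩ := hcover u₀ hu₀
  obtain ⟨C₀, D₀, Y₀, h₀⟩ := hK₀.prop
  have hsub : U ⊆ {v | ∃ C D K, IsPiece G w ε C D Y₀ K ∧ Maximal (· ∈ P) K ∧ v ∈ K} := by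
    refine hU.1.2.1.subset_of_closed hu₀ ⟨C₀, D₀, K₀, h₀, hK₀, hu₀K⟩ ?_
    rintro a - ⟨C, D, K, h, hK, haK⟩ b hb hab
    obtain ⟨L, hL, hbL⟩ := hcover b hb
    obtain ⟨C', D', Y', h'⟩ := hL.prop
    rcases IsPiece.subset_or_subset_or_eq hG hcoh hw h6 h h' haK hbL hab with hKL | hLK | rfl
    · exact ⟨C, D, K, h, hK, hK.le_of_ge hL.prop hKL hbL⟩
    · exact ⟨C, D, K, h, hK, hLK hbL⟩
    · exact ⟨C', D', L, h', hL, hbL⟩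
  have hmin := hcoh.2.2 U Y₀
    (Set.disjoint_left.mpr fun v hv hvY => by
      obtain ⟨C, D, K, h, -, hvK⟩ := hsub hv
      exact Set.disjoint_left.mp h.disjoint_big hvK hvY)
    (fun a ha b hb => by
      obtain ⟨C, D, K, h, -, haK⟩ := hsub ha
      exact h.not_adj_big haK hb)
  have hUw := hU.2
  have hYw := h₀.lt_setSum_big hcoh hw
  rcases min_lt_iff.mp hmin with h | h <;> linarith

end EHhat
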